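/- For every integer ℓ ≥ 0 there is a planar graph G such that for every graph H and every path P, if G is contained in H ⊠ P ⊠ K_ℓ then H has treewidth at least 3. -/

import Mathlib

/-!
Common definitions: multigraphs, combinatorial (cellular) surface embeddings,
Euler genus, framed graphs, strong products, treewidth, partitions and layerings.
-/

/-- A multigraph on vertex type `V` with edge type `E`, given by its endpoints map. -/
structure Multigraph (V E : Type) where
  ends : E → Sym2 V

namespace Multigraph

variable {V E F : Type}

/-- The simple graph underlying a multigraph. -/
def simple (G : Multigraph V E) : SimpleGraph V where
  Adj u v := u ≠ v ∧ ∃ e, G.ends e = s(u, v)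
  symm := by
    constructor
    rintro u v ⟨hne, e, he⟩
    exact ⟨hne.symm, e, he.trans Sym2.eq_swap⟩
  loopless := by constructor; rintro u ⟨hne, -⟩; exact hne rfl

/-- The simple graph on `V` whose edges are the edges of `G` lying in `S`. -/
def simpleOn (G : Multigraph V E) (S : Set E) : SimpleGraph V where
  Adj u v := u ≠ v ∧ ∃ e ∈ S, G.ends e = s(u, v)
  symm := by
    constructor
    rintro u v ⟨hne, e, heS, he⟩
    exact ⟨hne.symm, e, heS, he.trans Sym2.eq_swap⟩
  loopless := by constructor; rintro u ⟨hne, -⟩; exact hne rfl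

/-- A multigraph is simple: no loops and no parallel edges. -/
def IsSimple (G : Multigraph V E) : Prop :=
  (∀ e, ¬ (G.ends e).IsDiag) ∧ Function.Injective G.ends

/-- A set `S` of edges of `G` forms a spanning tree of `G`. -/
def IsSpanningTree (G : Multigraph V E) (S : Set E) : Prop :=
  (G.simpleOn S).IsTree ∧ (∀ e ∈ S, ¬ (G.ends e).IsDiag) ∧
    ∀ e ∈ S, ∀ e' ∈ S, G.ends e = G.ends e' → e = e'

/-- A closed walk in a multigraph, recorded as periodic sequences of vertices and
edges: the walk visits `vtx 0, vtx 1, …, vtx (len - 1)` and returns to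
`vtx len = vtx 0`, traversing the edge `edge i` between `vtx i` and `vtx (i+1)`. -/
structure CWalk (G : Multigraph V E) where
  len : ℕ
  len_pos : 0 < len
  vtx : ℕ → V
  edge : ℕ → E
  vtx_per : ∀ i, vtx (i + len) = vtx i
  edge_per : ∀ i, edge (i + len) = edge i
  compat : ∀ i, G.ends (edge i) = s(vtx i, vtx (i + 1))

namespace CWalk

variable {G : Multigraph V E}

/-- The vertex `v` lies on the closed walk `W`. -/
def HasVtx (W : G.CWalk) (v : V) : Prop := ∃ i, i < W.len ∧ W.vtx i = v

/-- The edge `e` lies on the closed walk `W`. -/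
def HasEdge (W : G.CWalk) (e : E) : Prop := ∃ i, i < W.len ∧ W.edge i = e

/-- The closed walk `W` is a cycle: it repeats no vertex and no edge. -/
def IsCycle (W : G.CWalk) : Prop :=
  (∀ i j, i < W.len → j < W.len → W.vtx i = W.vtx j → i = j) ∧
  (∀ i j, i < W.len → j < W.len → W.edge i = W.edge j → i = j)

end CWalk

/-- `p = (f, i)` is an occurrence of the edge `e` in the family `bd` of closed walks:
the walk of face `f` traverses `e` at position `i`. -/
def IsOcc {G : Multigraph V E} (bd : F → G.CWalk) (e : E) (p : F × ℕ) : Prop :=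
  p.2 < (bd p.1).len ∧ (bd p.1).edge p.2 = e

/-- `c = (f, i)` is a corner of the vertex `v`: the walk of face `f` visits `v`
at position `i`. -/
def IsCorner {G : Multigraph V E} (bd : F → G.CWalk) (v : V) (c : F × ℕ) : Prop :=
  c.2 < (bd c.1).len ∧ (bd c.1).vtx c.2 = v

/-- The corner `c` is one of the two end corners of the edge occurrence `p`. -/
def EndOf {G : Multigraph V E} (bd : F → G.CWalk) (c p : F × ℕ) : Prop :=
  c.1 = p.1 ∧ (c.2 = p.2 ∨ c.2 = (p.2 + 1) % (bd p.1).len)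

/-- Two corners of `v` are linked if they are end corners (at `v`) of the two
distinct occurrences of a common edge; this is the edge-to-edge gluing relation
around the vertex `v`. -/
def CornerLinked {G : Multigraph V E} (bd : F → G.CWalk) (v : V) (c c' : F × ℕ) : Prop :=
  IsCorner bd v c ∧ IsCorner bd v c' ∧
    ∃ (e : E) (p p' : F × ℕ), p ≠ p' ∧ IsOcc bd e p ∧ IsOcc bd e p' ∧
      EndOf bd c p ∧ EndOf bd c' p'

/-- A combinatorial (cellular) embedding of a connected multigraph `G` in a closed
surface, with face set `F`: every face is given by its closed boundary walk, every
edge of `G` is traversed exactly twice in total by the boundary walks, and the link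
of every vertex is connected (so the embedding is in a genuine surface, with no
pinch points). -/
structure Embedding (G : Multigraph V E) (F : Type) where
  boundary : F → G.CWalk
  conn : G.simple.Connected
  edge_twice : ∀ e : E, {p : F × ℕ | IsOcc boundary e p}.ncard = 2
  link_conn : ∀ (v : V) (c c' : F × ℕ), IsCorner boundary v c → IsCorner boundary v c' →
    Relation.EqvGen (CornerLinked boundary v) c c'

/-- The Euler genus `2 - (|V| - |E| + |F|)` of an embedding, via Euler's formula. -/
noncomputable def Embedding.eulerGenus {G : Multigraph V E} {F : Type}
    (_ : Embedding G F) : ℤ :=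
  2 - ((Nat.card V : ℤ) - Nat.card E + Nat.card F)

/-- The simple graph underlying the framed multigraph `G^{(d)}`: two distinct
vertices are adjacent iff they are joined by an edge of `G` or lie on a common
face of length at most `d` (in which case `G^{(d)}` has a chord between them). -/
def framedGraph {G : Multigraph V E} {F : Type} (emb : Embedding G F) (d : ℕ) :
    SimpleGraph V where
  Adj u v := u ≠ v ∧ ((∃ e, G.ends e = s(u, v)) ∨
    ∃ f, (emb.boundary f).len ≤ d ∧ (emb.boundary f).HasVtx u ∧ (emb.boundary f).HasVtx v)
  symm := by
    constructor
    rintro u v ⟨hne, (⟨e, he⟩ | ⟨f, h1, h2, h3⟩)⟩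
    · exact ⟨hne.symm, Or.inl ⟨e, he.trans Sym2.eq_swap⟩⟩
    · exact ⟨hne.symm, Or.inr ⟨f, h1, h3, h2⟩⟩
  loopless := by constructor; rintro u ⟨hne, -⟩; exact hne rfl

end Multigraph

namespace SimpleGraph

/-- `G` is contained in `X`: `G` is isomorphic to a subgraph of `X`. -/
def IsContainedIn {α β : Type} (G : SimpleGraph α) (X : SimpleGraph β) : Prop :=
  ∃ f : G →g X, Function.Injective f

/-- The strong product of two simple graphs. -/
def strongProd {α β : Type} (G : SimpleGraph α) (H : SimpleGraph β) :
    SimpleGraph (α × β) where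
  Adj x y := x ≠ y ∧ (x.1 = y.1 ∨ G.Adj x.1 y.1) ∧ (x.2 = y.2 ∨ H.Adj x.2 y.2)
  symm := by
    constructor
    rintro x y ⟨hne, h1, h2⟩
    exact ⟨hne.symm, h1.imp Eq.symm (fun h => G.adj_symm h), h2.imp Eq.symm (fun h => H.adj_symm h)⟩
  loopless := by constructor; rintro x ⟨hne, -⟩; exact hne rfl

end SimpleGraph

/-- `G` has treewidth at most `k`: it has a tree-decomposition with all bags of
size at most `k + 1`. -/
def TreewidthLE {α : Type} (G : SimpleGraph α) (k : ℕ) : Prop :=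
  ∃ (ι : Type) (T : SimpleGraph ι) (B : ι → Set α),
    T.IsTree ∧
    (∀ v, ∃ i, v ∈ B i) ∧
    (∀ u v, G.Adj u v → ∃ i, u ∈ B i ∧ v ∈ B i) ∧
    (∀ v, (T.induce {i | v ∈ B i}).Connected) ∧
    ∀ i, (B i).encard ≤ (k : ℕ∞) + 1

/-- `G` has Euler genus at most `g`: `G` is (isomorphic to) a subgraph of a
multigraph having a combinatorial embedding of Euler genus at most `g`. -/
def HasEulerGenusLE {α : Type} (G : SimpleGraph α) (g : ℕ) : Prop :=
  ∃ (V' E' F' : Type), Finite V' ∧ Finite E' ∧ Finite F' ∧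
    ∃ (M : Multigraph V' E') (emb : M.Embedding F'),
      emb.eulerGenus ≤ (g : ℤ) ∧ G.IsContainedIn M.simple

/-- A planar graph: a graph of Euler genus `0`. -/
def IsPlanar {α : Type} (G : SimpleGraph α) : Prop := HasEulerGenusLE G 0

/-- An apex graph: deleting some vertex leaves a planar graph. -/
def IsApex {α : Type} (G : SimpleGraph α) : Prop :=
  ∃ v : α, IsPlanar (G.induce {w | w ≠ v})

/-- `A` indexes a partition of the vertices of `G` into nonempty parts `A x`, and the
quotient of `G` by this partition is (isomorphic to) `H`, via the indexing: this is an
`H`-partition of `G`. -/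
def IsHPartition {α W : Type} (G : SimpleGraph α) (H : SimpleGraph W) (A : W → Set α) : Prop :=
  (∀ x, (A x).Nonempty) ∧ (∀ v, ∃! x, v ∈ A x) ∧
    ∀ x y, x ≠ y → (H.Adj x y ↔ ∃ u ∈ A x, ∃ v ∈ A y, G.Adj u v)

/-- `(L 0, L 1, …)` is a layering of `G`: an ordered partition of the vertices such
that every edge joins vertices in the same or in consecutive layers. -/
def IsLayering {α : Type} (G : SimpleGraph α) (L : ℕ → Set α) : Prop :=
  (∀ v, ∃! j, v ∈ L j) ∧
    ∀ u v, G.Adj u v → ∀ i j, u ∈ L i → v ∈ L j → i ≤ j + 1 ∧ j ≤ i + 1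

/-- `b` lies on every walk from `a` to `c` in `T` (for a tree: `b` is on the unique
`a`–`c` path). -/
def BtwIn {α : Type} (T : SimpleGraph α) (a b c : α) : Prop :=
  ∀ p : T.Walk a c, b ∈ p.support

/-- `Q` is the vertex set of a vertical path in the tree `T` rooted at `r` with upper
end `w` and lower end `u`: `w` lies on the path from `r` to `u`, and `Q` is the set of
vertices of the `w`–`u` path. -/
def IsVerticalPathBtw {α : Type} (T : SimpleGraph α) (r : α) (Q : Set α) (w u : α) : Prop :=
  BtwIn T r w u ∧ Q = {x | BtwIn T w x u}

/-- `Q` is the vertex set of a vertical path in the tree `T` rooted at `r`. -/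
def IsVerticalPath {α : Type} (T : SimpleGraph α) (r : α) (Q : Set α) : Prop :=
  ∃ w u, IsVerticalPathBtw T r Q w u

/-- `Y` is the union of at most `k` vertical paths in the tree `T` rooted at `r`. -/
def IsUnionOfVPaths {α : Type} (T : SimpleGraph α) (r : α) (k : ℕ) (Y : Set α) : Prop :=
  ∃ m, m ≤ k ∧ ∃ Q : Fin m → Set α, (∀ i, IsVerticalPath T r (Q i)) ∧ Y = ⋃ i, Q i

section TreeHelly

/-- Convexity in a tree. -/
def TConv {ι : Type} (T : SimpleGraph ι) (S : Set ι) : Prop :=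
  ∀ a ∈ S, ∀ b ∈ S, ∀ p : T.Walk a b, p.IsPath → ∀ x ∈ p.support, x ∈ S

lemma TConv.inter {ι : Type} {T : SimpleGraph ι} {S S' : Set ι} (h : TConv T S)
    (h' : TConv T S') : TConv T (S ∩ S') := by
  intro a ha b hb p hp x hx
  exact ⟨h a ha.1 b hb.1 p hp x hx, h' a ha.2 b hb.2 p hp x hx⟩

lemma tconv_of_connected {ι : Type} {T : SimpleGraph ι} (hT : T.IsTree) {S : Set ι}
    (h : (T.induce S).Connected) : TConv T S := by
  classical
  intro a ha b hb p hp x hx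
  obtain ⟨q⟩ := h.preconnected ⟨a, ha⟩ ⟨b, hb⟩
  let q' : T.Walk a b := q.map (SimpleGraph.Embedding.induce S).toHom
  have e : (⟨p, hp⟩ : T.Path a b) = q'.toPath := (hT.isAcyclic.subsingleton_path a b).elim _ _
  have e' : p = q'.bypass := congrArg Subtype.val e
  rw [e'] at hx
  have := q'.support_bypass_subset_support hx
  rw [show q'.support = _ from SimpleGraph.Walk.support_map _ _] at this
  obtain ⟨y, -, hy⟩ := List.mem_map.1 this
  rw [← hy]
  exact y.2

lemma walk_cross {ι : Type} {T : SimpleGraph ι} {S S' : Set ι} {a c : ι} (p : T.Walk a c) :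
    a ∈ S → c ∈ S' → (∀ x y, s(x, y) ∈ p.edges → (x ∈ S ∧ y ∈ S) ∨ (x ∈ S' ∧ y ∈ S')) →
    ∃ x ∈ p.support, x ∈ S ∧ x ∈ S' := by
  induction p with
  | nil => intro h1 h2 _; exact ⟨_, by simp, h1, h2⟩
  | @cons u v w h p ih =>
    intro h1 h2 h3
    rcases h3 u v (by simp) with h4 | h4
    · obtain ⟨x, hx, hx'⟩ := ih h4.2 h2 (fun x y hxy => h3 x y (by simp [hxy]))
      exact ⟨x, by simp [hx], hx'⟩
    · exact ⟨_, by simp, h1, h4.1⟩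

lemma helly3 {ι : Type} {T : SimpleGraph ι} (hT : T.IsTree) {S1 S2 S3 : Set ι}
    (h1 : TConv T S1) (h2 : TConv T S2) (h3 : TConv T S3)
    (h12 : (S1 ∩ S2).Nonempty) (h23 : (S2 ∩ S3).Nonempty) (h13 : (S1 ∩ S3).Nonempty) :
    (S1 ∩ S2 ∩ S3).Nonempty := by
  classical
  obtain ⟨a, ha1, ha2⟩ := h12
  obtain ⟨b, hb2, hb3⟩ := h23
  obtain ⟨c, hc1, hc3⟩ := h13
  obtain ⟨q⟩ := hT.1.preconnected a b
  obtain ⟨r⟩ := hT.1.preconnected b c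
  let w := q.bypass.append r.bypass
  obtain ⟨x, hx, hx2, hx3⟩ := walk_cross (S := S2) (S' := S3) w.bypass ha2 hc3 (by
    intro x y hxy
    have := w.edges_bypass_subset_edges hxy
    rw [SimpleGraph.Walk.edges_append, List.mem_append] at this
    rcases this with h | h
    · left
      exact ⟨h2 a ha2 b hb2 _ q.bypass_isPath _ (SimpleGraph.Walk.fst_mem_support_of_mem_edges _ h),
        h2 a ha2 b hb2 _ q.bypass_isPath _ (SimpleGraph.Walk.snd_mem_support_of_mem_edges _ h)⟩
    · right
      exact ⟨h3 b hb3 c hc3 _ r.bypass_isPath _ (SimpleGraph.Walk.fst_mem_support_of_mem_edges _ h),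
        h3 b hb3 c hc3 _ r.bypass_isPath _ (SimpleGraph.Walk.snd_mem_support_of_mem_edges _ h)⟩)
  exact ⟨x, ⟨h1 a ha1 c hc1 _ w.bypass_isPath x hx, hx2⟩, hx3⟩

lemma no_K4 {W : Type} {H : SimpleGraph W} (hH : TreewidthLE H 2) {a b c d : W}
    (hab : H.Adj a b) (hac : H.Adj a c) (had : H.Adj a d) (hbc : H.Adj b c)
    (hbd : H.Adj b d) (hcd : H.Adj c d) : False := by
  obtain ⟨ι, T, B, hT, -, hE, hC, hB⟩ := hH
  have cv : ∀ v, TConv T {i | v ∈ B i} := fun v => tconv_of_connected hT (hC v)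
  have ne : ∀ u v, H.Adj u v → ({i | u ∈ B i} ∩ {i | v ∈ B i}).Nonempty := fun u v h => by
    obtain ⟨i, h1, h2⟩ := hE u v h
    exact ⟨i, h1, h2⟩
  have ne3 : ∀ u v w, H.Adj u v → H.Adj v w → H.Adj u w →
      ({i | u ∈ B i} ∩ {i | v ∈ B i} ∩ {i | w ∈ B i}).Nonempty := fun u v w h1 h2 h3 =>
    helly3 hT (cv u) (cv v) (cv w) (ne _ _ h1) (ne _ _ h2) (ne _ _ h3)
  obtain ⟨i, ⟨⟨h1, h2⟩, h3, h2'⟩, h4, -⟩ := helly3 hT ((cv a).inter (cv d)) ((cv b).inter (cv d)) ((cv c).inter (cv d))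
    (by obtain ⟨i, ⟨h1, h2⟩, h3⟩ := ne3 a b d hab hbd had; exact ⟨i, ⟨h1, h3⟩, h2, h3⟩)
    (by obtain ⟨i, ⟨h1, h2⟩, h3⟩ := ne3 b c d hbc hcd hbd; exact ⟨i, ⟨h1, h3⟩, h2, h3⟩)
    (by obtain ⟨i, ⟨h1, h2⟩, h3⟩ := ne3 a c d hac hcd had; exact ⟨i, ⟨h1, h3⟩, h2, h3⟩)
  have hsub : ({a, b, c, d} : Set W) ⊆ B i := by
    intro x hx
    simp only [Set.mem_insert_iff, Set.mem_singleton_iff] at hx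
    rcases hx with rfl | rfl | rfl | rfl <;> assumption
  have h5 := (Set.encard_le_encard hsub).trans (hB i)
  rw [Set.encard_insert_of_notMem (by simp [hab.ne, hac.ne, had.ne]),
    Set.encard_insert_of_notMem (by simp [hbc.ne, hbd.ne]), Set.encard_pair hcd.ne] at h5
  exact absurd h5 (by decide)

end TreeHelly

section Construction

set_option linter.all false
set_option linter.unusedSectionVars false
set_option linter.unusedSimpArgs false

open Multigraph

def mkW {V E : Type} (G : Multigraph V E) (len : ℕ) (hl : 0 < len) (vt : ℕ → V) (ed : ℕ → E)
    (h : ∀ i < len, G.ends (ed i) = s(vt i, vt ((i + 1) % len))) : G.CWalk where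
  len := len
  len_pos := hl
  vtx i := vt (i % len)
  edge i := ed (i % len)
  vtx_per i := by simp
  edge_per i := by simp
  compat i := by rw [h _ (Nat.mod_lt _ hl), Nat.mod_add_mod]

abbrev DD (N K : ℕ) := ZMod N × Fin (K + 2)
abbrev CC (N K : ℕ) := ZMod N × Fin (K + 1)
abbrev EE (N K : ℕ) := DD N K ⊕ (DD N K ⊕ CC N K)
abbrev FF (N K : ℕ) := DD N K ⊕ (CC N K ⊕ Unit)

variable {N K : ℕ}

def nxt (d : DD N K) : DD N K :=
  if h : d.2.val < K + 1 then (d.1, ⟨d.2.val + 1, by omega⟩) else (d.1 + 1, 0)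

def prv (d : DD N K) : DD N K :=
  if d.2.val = 0 then (d.1 - 1, Fin.last _) else (d.1, ⟨d.2.val - 1, by omega⟩)

lemma nxt_prv (d : DD N K) : nxt (prv d) = d := by
  obtain ⟨i, j, hj⟩ := d
  unfold prv
  split_ifs with h
  · simp only at h; subst h; simp [nxt]
  · simp only at h
    have : j - 1 < K + 1 := by omega
    simp [nxt, this]; omega

lemma prv_nxt (d : DD N K) : prv (nxt d) = d := by
  obtain ⟨i, j, hj⟩ := d
  unfold nxt
  split_ifs with h
  · simp [prv]
  · simp only at h
    have : j = K + 1 := by omega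
    subst this
    simp [prv, Fin.last]

lemma nxt_castSucc (i : ZMod N) (j : Fin (K + 1)) :
    nxt ((i, j.castSucc) : DD N K) = (i, j.succ) := by
  have := j.2
  simp only [nxt, Fin.val_castSucc, this, dif_pos]
  rfl

lemma nxt_last (i : ZMod N) : nxt ((i, Fin.last _) : DD N K) = (i + 1, 0) := by
  simp [nxt]

/-- The multigraph: hub `none`, cycle of all `some d`, chords. -/
def MM (N K : ℕ) : Multigraph (Option (DD N K)) (EE N K) where
  ends e := match e with
    | .inl d => s(none, some d)
    | .inr (.inl d) => s(some d, some (nxt d))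
    | .inr (.inr c) => s(some (c.1, 0), some (c.1, c.2.succ))

def vtT (d : DD N K) : ℕ → Option (DD N K)
  | 0 => none
  | 1 => some d
  | _ => some (nxt d)

def edT (d : DD N K) : ℕ → EE N K
  | 0 => .inl d
  | 1 => .inr (.inl d)
  | _ => .inl (nxt d)

def prd (j : Fin (K + 1)) : Fin (K + 1) := ⟨j.val - 1, by omega⟩

def vtF (c : CC N K) : ℕ → Option (DD N K)
  | 0 => some (c.1, c.2.castSucc)
  | 1 => some (c.1, c.2.succ)
  | _ => some (c.1, 0)

def edF (c : CC N K) : ℕ → EE N K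
  | 0 => .inr (.inl (c.1, c.2.castSucc))
  | 1 => .inr (.inr c)
  | _ => .inr (.inr (c.1, prd c.2))

def lenF (c : CC N K) : ℕ := if c.2 = 0 then 2 else 3

def vtO (k : ℕ) : Option (DD N K) :=
  if k % 2 = 0 then some (((k / 2 : ℕ) : ZMod N), 0) else some (((k / 2 : ℕ) : ZMod N), Fin.last _)

def edO (k : ℕ) : EE N K :=
  if k % 2 = 0 then .inr (.inr (((k / 2 : ℕ) : ZMod N), Fin.last _))
  else .inr (.inl (((k / 2 : ℕ) : ZMod N), Fin.last _))

def bd (N K : ℕ) [NeZero N] : FF N K → (MM N K).CWalk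
  | .inl d => mkW _ 3 (by norm_num) (vtT d) (edT d) (by
      intro i hi
      interval_cases i
      · simp [MM, vtT, edT]
      · simp [MM, vtT, edT]
      · simp [MM, vtT, edT, Sym2.eq_swap])
  | .inr (.inl c) => mkW _ (lenF c) (by unfold lenF; split_ifs <;> norm_num) (vtF c) (edF c) (by
      intro i hi
      obtain ⟨a, j⟩ := c
      unfold lenF at *
      split_ifs at * with h
      · simp only at h
        subst h
        interval_cases i
        · simp [MM, vtF, edF, nxt]
        · simp [MM, vtF, edF, Sym2.eq_swap]
      · simp only at h
        interval_cases i
        · simp [MM, vtF, edF, nxt_castSucc]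
        · simp [MM, vtF, edF, Sym2.eq_swap]
        · have h0 : j.val ≠ 0 := fun h' => h (Fin.ext h')
          have : (prd j).succ = j.castSucc := by
            ext; simp [prd]; omega
          simp [MM, vtF, edF, this])
  | .inr (.inr _) => mkW _ (2 * N) (by have := NeZero.pos N; omega) vtO edO (by
      intro i hi
      rcases Nat.even_or_odd' i with ⟨k, rfl | rfl⟩
      · have : (2 * k + 1) % (2 * N) = 2 * k + 1 := Nat.mod_eq_of_lt (by omega)
        have h2 : (2 * k + 1) / 2 = k := by omega
        simp [MM, edO, vtO, this, h2]
      · have h2 : (2 * k + 1) / 2 = k := by omega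
        have h3 : (2 * k + 1 + 1) % (2 * N) = 2 * ((k + 1) % N) := by
          rw [show 2 * k + 1 + 1 = 2 * (k + 1) by ring, Nat.mul_mod_mul_left]
        simp [MM, edO, vtO, h2, h3, nxt_last])

variable [NeZero N]

lemma occT (e : EE N K) (d : DD N K) (k : ℕ) :
    IsOcc (bd N K) e (.inl d, k) ↔ k < 3 ∧ edT d k = e := by
  simp only [IsOcc, bd, mkW]
  refine and_congr_right fun h => ?_
  rw [Nat.mod_eq_of_lt h]

lemma occF (e : EE N K) (c : CC N K) (k : ℕ) :
    IsOcc (bd N K) e (.inr (.inl c), k) ↔ k < lenF c ∧ edF c k = e := by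
  simp only [IsOcc, bd, mkW]
  refine and_congr_right fun h => ?_
  rw [Nat.mod_eq_of_lt h]

lemma occO (e : EE N K) (u : Unit) (k : ℕ) :
    IsOcc (bd N K) e (.inr (.inr u), k) ↔ k < 2 * N ∧ edO k = e := by
  simp only [IsOcc, bd, mkW]
  refine and_congr_right fun h => ?_
  rw [Nat.mod_eq_of_lt h]

lemma corT (v : Option (DD N K)) (d : DD N K) (k : ℕ) :
    Multigraph.IsCorner (bd N K) v (.inl d, k) ↔ k < 3 ∧ vtT d k = v := by
  simp only [Multigraph.IsCorner, bd, mkW]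
  refine and_congr_right fun h => ?_
  rw [Nat.mod_eq_of_lt h]

lemma corF (v : Option (DD N K)) (c : CC N K) (k : ℕ) :
    Multigraph.IsCorner (bd N K) v (.inr (.inl c), k) ↔ k < lenF c ∧ vtF c k = v := by
  simp only [Multigraph.IsCorner, bd, mkW]
  refine and_congr_right fun h => ?_
  rw [Nat.mod_eq_of_lt h]

lemma corO (v : Option (DD N K)) (u : Unit) (k : ℕ) :
    Multigraph.IsCorner (bd N K) v (.inr (.inr u), k) ↔ k < 2 * N ∧ vtO k = v := by
  simp only [Multigraph.IsCorner, bd, mkW]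
  refine and_congr_right fun h => ?_
  rw [Nat.mod_eq_of_lt h]

lemma lenF_cases (c : CC N K) : (c.2 = 0 ∧ lenF c = 2) ∨ (c.2 ≠ 0 ∧ lenF c = 3) := by
  unfold lenF
  split_ifs with h
  · exact .inl ⟨h, rfl⟩
  · exact .inr ⟨h, rfl⟩

lemma cast_eq_iff (k : ℕ) (hk : k < N) (i : ZMod N) : ((k : ZMod N) = i) ↔ k = i.val := by
  constructor
  · rintro rfl; rw [ZMod.val_natCast_of_lt hk]
  · rintro rfl; simp

lemma edO_chord (k : ℕ) (hk : k < 2 * N) (c : CC N K) :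
    edO k = (.inr (.inr c) : EE N K) ↔ c.2 = Fin.last _ ∧ k = 2 * c.1.val := by
  obtain ⟨i, j⟩ := c
  have := cast_eq_iff (k / 2) (by omega) i
  unfold edO
  split_ifs with h
  · simp only [Sum.inr.injEq, Prod.mk.injEq, this]
    constructor
    · rintro ⟨h1, h2⟩; exact ⟨h2.symm, by omega⟩
    · rintro ⟨h1, h2⟩; exact ⟨by omega, h1.symm⟩
  · simp only [Sum.inr.injEq, reduceCtorEq, false_iff]
    rintro ⟨-, h2⟩; omega

lemma edO_cyc (k : ℕ) (hk : k < 2 * N) (d : DD N K) :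
    edO k = (.inr (.inl d) : EE N K) ↔ d.2 = Fin.last _ ∧ k = 2 * d.1.val + 1 := by
  obtain ⟨i, j⟩ := d
  have := cast_eq_iff (k / 2) (by omega) i
  unfold edO
  split_ifs with h
  · simp only [Sum.inr.injEq, reduceCtorEq, false_iff]
    rintro ⟨-, h2⟩; omega
  · simp only [Sum.inr.injEq, Sum.inl.injEq, Prod.mk.injEq, this]
    constructor
    · rintro ⟨h1, h2⟩; exact ⟨h2.symm, by omega⟩
    · rintro ⟨h1, h2⟩; exact ⟨by omega, h1.symm⟩

lemma edO_spoke (k : ℕ) (d : DD N K) : edO k ≠ (.inl d : EE N K) := by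
  unfold edO
  split_ifs <;> simp

lemma edF_spoke (c : CC N K) (k : ℕ) (d : DD N K) : edF c k ≠ (.inl d : EE N K) := by
  rcases k with _ | _ | k <;> simp [edF]

lemma edF_cyc (c : CC N K) (k : ℕ) (d : DD N K) :
    edF c k = (.inr (.inl d) : EE N K) ↔ k = 0 ∧ d = (c.1, c.2.castSucc) := by
  rcases k with _ | _ | k <;> simp [edF, eq_comm]

lemma edT_chord (d : DD N K) (k : ℕ) (c : CC N K) : edT d k ≠ (.inr (.inr c) : EE N K) := by
  rcases k with _ | _ | k <;> simp [edT]

lemma edT_cyc (d : DD N K) (k : ℕ) (d' : DD N K) :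
    edT d k = (.inr (.inl d') : EE N K) ↔ k = 1 ∧ d' = d := by
  rcases k with _ | _ | k <;> simp [edT, eq_comm]

lemma nxt_eq_iff (d d' : DD N K) : nxt d = d' ↔ d = prv d' := by
  constructor
  · rintro rfl; rw [prv_nxt]
  · rintro rfl; rw [nxt_prv]

lemma occ_spoke (d : DD N K) :
    {p : FF N K × ℕ | IsOcc (bd N K) (.inl d) p} = {(.inl d, 0), (.inl (prv d), 2)} := by
  ext ⟨f | f | f, k⟩
  · simp only [Set.mem_ofPred_eq, occT, Set.mem_insert_iff, Set.mem_singleton_iff, Prod.mk.injEq,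
      Sum.inl.injEq]
    constructor
    · rintro ⟨h1, h2⟩
      interval_cases k <;> simp_all [edT, nxt_eq_iff]
    · rintro (⟨rfl, rfl⟩ | ⟨rfl, rfl⟩) <;> simp [edT, nxt_prv]
  · simp [occF, edF_spoke]
  · simp [occO, edO_spoke]

lemma occ_cyc1 (i : ZMod N) (j : Fin (K + 1)) :
    {p : FF N K × ℕ | IsOcc (bd N K) (.inr (.inl (i, j.castSucc))) p} =
      {(.inl (i, j.castSucc), 1), (.inr (.inl (i, j)), 0)} := by
  ext ⟨f | f | f, k⟩
  · simp only [Set.mem_ofPred_eq, occT, Set.mem_insert_iff, Set.mem_singleton_iff, Prod.mk.injEq,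
      Sum.inl.injEq, edT_cyc, reduceCtorEq, false_and, or_false]
    constructor
    · rintro ⟨h1, h2, h3⟩; exact ⟨h3.symm, h2⟩
    · rintro ⟨h1, h2⟩; exact ⟨by omega, h2, h1.symm⟩
  · obtain ⟨a, b⟩ := f
    simp only [Set.mem_ofPred_eq, occF, Set.mem_insert_iff, Set.mem_singleton_iff, Prod.mk.injEq,
      Sum.inl.injEq, Sum.inr.injEq, edF_cyc, reduceCtorEq, false_and, false_or,
      Fin.castSucc_inj]
    constructor
    · rintro ⟨h1, h2, h3, h4⟩; exact ⟨⟨h3.symm, h4.symm⟩, h2⟩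
    · rintro ⟨⟨rfl, rfl⟩, h2⟩
      refine ⟨?_, h2, rfl, rfl⟩
      rcases lenF_cases (a, b) with h | h <;> omega
  · simp only [Set.mem_ofPred_eq, occO]
    constructor
    · rintro ⟨h1, h2⟩
      rw [edO_cyc _ h1] at h2
      exact absurd h2.1 (Fin.castSucc_lt_last j).ne
    · simp

lemma occ_cyc2 (i : ZMod N) :
    {p : FF N K × ℕ | IsOcc (bd N K) (.inr (.inl (i, Fin.last _))) p} =
      {(.inl (i, Fin.last _), 1), (.inr (.inr ()), 2 * i.val + 1)} := by
  ext ⟨f | f | f, k⟩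
  · simp only [Set.mem_ofPred_eq, occT, Set.mem_insert_iff, Set.mem_singleton_iff, Prod.mk.injEq,
      Sum.inl.injEq, edT_cyc, reduceCtorEq, false_and, or_false]
    constructor
    · rintro ⟨h1, h2, h3⟩; exact ⟨h3.symm, h2⟩
    · rintro ⟨h1, h2⟩; exact ⟨by omega, h2, h1.symm⟩
  · obtain ⟨a, b⟩ := f
    simp only [Set.mem_ofPred_eq, occF, Set.mem_insert_iff, Set.mem_singleton_iff, Prod.mk.injEq,
      Sum.inr.injEq, edF_cyc, reduceCtorEq, false_and, false_or, iff_false]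
    rintro ⟨h1, h2, h3, h4⟩
    exact absurd h4.symm (Fin.castSucc_lt_last b).ne
  · have := ZMod.val_lt i
    simp only [Set.mem_ofPred_eq, occO, Set.mem_insert_iff, Set.mem_singleton_iff, Prod.mk.injEq,
      Sum.inr.injEq, reduceCtorEq, false_and, false_or]
    constructor
    · rintro ⟨h1, h2⟩
      rw [edO_cyc _ h1] at h2
      exact ⟨trivial, h2.2⟩
    · rintro ⟨-, h⟩
      refine ⟨by omega, ?_⟩
      rw [edO_cyc _ (by omega)]
      exact ⟨rfl, h⟩

lemma occF_chord (c c' : CC N K) (k : ℕ) :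
    (k < lenF c ∧ edF c k = (.inr (.inr c') : EE N K)) ↔
      (k = 1 ∧ c = c') ∨ (k = 2 ∧ c.1 = c'.1 ∧ c.2.val = c'.2.val + 1) := by
  obtain ⟨a, b⟩ := c
  obtain ⟨a', b'⟩ := c'
  have hb : b = 0 ↔ b.val = 0 := Fin.ext_iff
  rcases lenF_cases (a, b) with ⟨h0, h⟩ | ⟨h0, h⟩ <;> rw [h] <;>
  rcases k with _ | _ | _ | k <;> simp [edF, prd, Fin.ext_iff] <;> simp only [ne_eq, hb] at h0 <;> omega

lemma occ_chord1 (i : ZMod N) (j : Fin K) :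
    {p : FF N K × ℕ | IsOcc (bd N K) (.inr (.inr (i, j.castSucc))) p} =
      {(.inr (.inl (i, j.castSucc)), 1), (.inr (.inl (i, j.succ)), 2)} := by
  ext ⟨f | f | f, k⟩
  · simp [occT, edT_chord]
  · obtain ⟨a, b⟩ := f
    simp only [Set.mem_ofPred_eq, occF, occF_chord]
    simp [Fin.ext_iff]
    tauto
  · simp only [Set.mem_ofPred_eq, occO]
    constructor
    · rintro ⟨h1, h2⟩
      rw [edO_chord _ h1] at h2
      exact absurd h2.1 (Fin.castSucc_lt_last j).ne
    · simp

lemma occ_chord2 (i : ZMod N) :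
    {p : FF N K × ℕ | IsOcc (bd N K) (.inr (.inr (i, Fin.last _))) p} =
      {(.inr (.inl (i, Fin.last _)), 1), (.inr (.inr ()), 2 * i.val)} := by
  ext ⟨f | f | f, k⟩
  · simp [occT, edT_chord]
  · obtain ⟨a, b⟩ := f
    simp only [Set.mem_ofPred_eq, occF, occF_chord]
    simp [Fin.ext_iff]
    have := b.2
    constructor
    · rintro (h | h)
      · tauto
      · omega
    · tauto
  · have := ZMod.val_lt i
    simp only [Set.mem_ofPred_eq, occO, Set.mem_insert_iff, Set.mem_singleton_iff, Prod.mk.injEq,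
      Sum.inr.injEq, reduceCtorEq, false_and, false_or]
    constructor
    · rintro ⟨h1, h2⟩
      rw [edO_chord _ h1] at h2
      exact ⟨trivial, h2.2⟩
    · rintro ⟨-, h⟩
      refine ⟨by omega, ?_⟩
      rw [edO_chord _ (by omega)]
      exact ⟨rfl, h⟩

lemma edge_tw (e : EE N K) : {p : FF N K × ℕ | IsOcc (bd N K) e p}.ncard = 2 := by
  rcases e with d | ⟨i, j⟩ | ⟨i, j⟩
  · rw [occ_spoke, Set.ncard_pair (by simp)]
  · induction j using Fin.lastCases with
    | last => rw [occ_cyc2, Set.ncard_pair (by simp)]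
    | cast j => rw [occ_cyc1, Set.ncard_pair (by simp)]
  · induction j using Fin.lastCases with
    | last => rw [occ_chord2, Set.ncard_pair (by simp)]
    | cast j => rw [occ_chord1, Set.ncard_pair (by simp)]

end Construction

section Construction2
set_option linter.all false
set_option linter.unusedSectionVars false
set_option linter.unusedSimpArgs false

open Multigraph Relation

variable {N K : ℕ} [NeZero N]

/-- linked -/
abbrev LK (v : Option (DD N K)) (c c' : FF N K × ℕ) : Prop := EqvGen (CornerLinked (bd N K) v) c c'

lemma lk_hub (d : DD N K) : LK none (.inl d, 0) (.inl (nxt d), 0) := by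
  refine EqvGen.rel _ _ ⟨?_, ?_, .inl (nxt d), (.inl d, 2), (.inl (nxt d), 0), by simp, ?_, ?_, ?_, ?_⟩
  · simp [corT, vtT]
  · simp [corT, vtT]
  · simp [occT, edT]
  · simp [occT, edT]
  · simp [EndOf, bd, mkW]
  · simp [EndOf, bd, mkW]

lemma lk_hub_row (i : ZMod N) (j : Fin (K + 2)) : LK (K := K) none (.inl (i, 0), 0) (.inl (i, j), 0) := by
  induction j using Fin.induction with
  | zero => exact EqvGen.refl _
  | succ j ih =>
    have := lk_hub (i, j.castSucc)
    rw [nxt_castSucc] at this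
    exact EqvGen.trans _ _ _ ih this

lemma lk_hub_all (d : DD N K) : LK (K := K) none (.inl (0, 0), 0) (.inl d, 0) := by
  have key : ∀ k : ℕ, LK (N := N) (K := K) none (.inl (0, 0), 0) (.inl ((k : ZMod N), 0), 0) := by
    intro k
    induction k with
    | zero => simpa using EqvGen.refl _
    | succ k ih =>
      have h1 := lk_hub_row (K := K) (k : ZMod N) (Fin.last _)
      have h2 := lk_hub ((k : ZMod N), Fin.last (K + 1))
      rw [nxt_last] at h2
      push_cast
      exact EqvGen.trans _ _ _ ih (EqvGen.trans _ _ _ h1 h2)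
  obtain ⟨i, j⟩ := d
  have := key i.val
  rw [ZMod.natCast_zmod_val] at this
  exact EqvGen.trans _ _ _ this (lk_hub_row i j)

lemma lk_T2 (d : DD N K) : LK (some (nxt d)) (.inl d, 2) (.inl (nxt d), 1) := by
  refine EqvGen.rel _ _ ⟨?_, ?_, .inl (nxt d), (.inl d, 2), (.inl (nxt d), 0), by simp, ?_, ?_, ?_, ?_⟩
  · simp [corT, vtT]
  · simp [corT, vtT]
  · simp [occT, edT]
  · simp [occT, edT]
  · simp [EndOf, bd, mkW]
  · simp [EndOf, bd, mkW]

lemma lenF_ge (c : CC N K) : 2 ≤ lenF c := by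
  rcases lenF_cases c with h | h <;> omega

lemma lk_F0 (i : ZMod N) (j : Fin (K + 1)) :
    LK (some (i, j.castSucc)) (.inr (.inl (i, j)), 0) (.inl (i, j.castSucc), 1) := by
  have := lenF_ge (i, j)
  refine EqvGen.rel _ _ ⟨?_, ?_, .inr (.inl (i, j.castSucc)), (.inr (.inl (i, j)), 0),
    (.inl (i, j.castSucc), 1), by simp, ?_, ?_, ?_, ?_⟩
  · simp [corF, vtF]; omega
  · simp [corT, vtT]
  · simp [occF, edF]; omega
  · simp [occT, edT]
  · simp [EndOf, bd, mkW]
  · simp [EndOf, bd, mkW]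

lemma lk_F1 (i : ZMod N) (j : Fin (K + 1)) :
    LK (some (i, j.succ)) (.inr (.inl (i, j)), 1) (.inl (i, j.succ), 1) := by
  have := lenF_ge (i, j)
  have h2 := lk_T2 (i, j.castSucc)
  rw [nxt_castSucc] at h2
  refine EqvGen.trans _ _ _ (EqvGen.rel _ _ ⟨?_, ?_, .inr (.inl (i, j.castSucc)), (.inr (.inl (i, j)), 0),
    (.inl (i, j.castSucc), 1), by simp, ?_, ?_, ?_, ?_⟩) h2
  · simp [corF, vtF]; omega
  · simp [corT, vtT, nxt_castSucc]
  · simp [occF, edF]; omega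
  · simp [occT, edT]
  · have : 1 % lenF (i, j) = 1 := Nat.mod_eq_of_lt (by omega)
    simp [EndOf, bd, mkW, this]
  · simp [EndOf, bd, mkW]

/-- the corner of fan `c` at the apex -/
def apx (c : CC N K) : ℕ := 2 % lenF c

lemma apx_cor (c : CC N K) : Multigraph.IsCorner (bd N K) (some (c.1, 0)) (.inr (.inl c), apx c) := by
  obtain ⟨i, j⟩ := c
  rcases lenF_cases (i, j) with ⟨h0, h⟩ | ⟨h0, h⟩
  · simp only at h0; subst h0; simp [corF, apx, h, vtF]
  · simp [corF, apx, h, vtF]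

lemma lk_apx (i : ZMod N) (j : Fin (K + 1)) :
    LK (some (i, 0)) (.inr (.inl (i, j)), apx (i, j)) (.inl (i, 0), 1) := by
  induction j using Fin.induction with
  | zero =>
    have := lk_F0 i (0 : Fin (K + 1))
    simpa [apx, lenF] using this
  | succ j ih =>
    have hl : lenF (i, j.succ) = 3 := by simp [lenF]
    have := lenF_ge (i, j.castSucc)
    refine EqvGen.trans _ _ _ (EqvGen.rel _ _ ⟨?_, ?_, .inr (.inr (i, j.castSucc)),
      (.inr (.inl (i, j.succ)), 2), (.inr (.inl (i, j.castSucc)), 1), by simp, ?_, ?_, ?_, ?_⟩) ih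
    · exact apx_cor (i, j.succ)
    · exact apx_cor (i, j.castSucc)
    · simp [occF, edF, hl, prd, Fin.ext_iff]
    · simp [occF, edF]; omega
    · simp [EndOf, bd, mkW, hl, apx]
    · simp [EndOf, bd, mkW, apx]

lemma lk_O0 (i : ZMod N) :
    LK (K := K) (some (i, 0)) (.inr (.inr ()), 2 * i.val) (.inl (i, 0), 1) := by
  have h1 := lenF_ge (i, Fin.last K)
  have h2 := ZMod.val_lt i
  refine EqvGen.trans _ _ _ (EqvGen.rel _ _ ⟨?_, ?_, .inr (.inr (i, Fin.last _)),
      (.inr (.inr ()), 2 * i.val), (.inr (.inl (i, Fin.last _)), 1), by simp, ?_, ?_, ?_, ?_⟩)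
      (lk_apx i (Fin.last _))
  · simp [corO, vtO, h2]
  · exact apx_cor (i, Fin.last _)
  · simp [occO, edO, h2]
  · simp [occF, edF]; omega
  · simp [EndOf]
  · simp [EndOf, bd, mkW, apx]

lemma lk_O1 (i : ZMod N) :
    LK (K := K) (some (i, Fin.last _)) (.inr (.inr ()), 2 * i.val + 1) (.inl (i, Fin.last _), 1) := by
  have h2 := ZMod.val_lt i
  have h3 : (2 * i.val + 1) / 2 = i.val := by omega
  refine (EqvGen.rel _ _ ⟨?_, ?_, .inr (.inl (i, Fin.last _)),
      (.inr (.inr ()), 2 * i.val + 1), (.inl (i, Fin.last _), 1), by simp, ?_, ?_, ?_, ?_⟩)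
  · simp [corO, vtO, h3]; omega
  · simp [corT, vtT]
  · simp [occO, edO, h3]; omega
  · simp [occT, edT]
  · simp [EndOf]
  · simp [EndOf]

lemma lk_none (c : FF N K × ℕ) (h : Multigraph.IsCorner (bd N K) none c) : LK none (.inl (0, 0), 0) c := by
  obtain ⟨f | f | f, k⟩ := c
  · rw [corT] at h
    obtain ⟨h1, h2⟩ := h
    interval_cases k <;> simp [vtT] at h2
    exact lk_hub_all f
  · rw [corF] at h
    rcases k with _ | _ | k <;> simp [vtF] at h
  · rw [corO] at h
    unfold vtO at h
    split_ifs at h <;> simp at h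

lemma lk_some (d : DD N K) (c : FF N K × ℕ) (h : Multigraph.IsCorner (bd N K) (some d) c) :
    LK (some d) c (.inl d, 1) := by
  obtain ⟨f | f | f, k⟩ := c
  · rw [corT] at h
    obtain ⟨h1, h2⟩ := h
    interval_cases k <;> simp [vtT] at h2
    · subst h2; exact EqvGen.refl _
    · subst h2; exact lk_T2 f
  · obtain ⟨i, j⟩ := f
    rw [corF] at h
    obtain ⟨h1, h2⟩ := h
    rcases lenF_cases (i, j) with ⟨h0, hl⟩ | ⟨h0, hl⟩
    · rw [hl] at h1
      interval_cases k <;> simp only [vtF, Option.some.injEq] at h2 <;> subst h2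
      · exact lk_F0 i j
      · exact lk_F1 i j
    · rw [hl] at h1
      interval_cases k <;> simp only [vtF, Option.some.injEq] at h2 <;> subst h2
      · exact lk_F0 i j
      · exact lk_F1 i j
      · simpa [apx, hl] using lk_apx i j
  · rw [corO] at h
    obtain ⟨h1, h2⟩ := h
    rcases Nat.even_or_odd' k with ⟨k, rfl | rfl⟩
    · simp [vtO] at h2
      subst h2
      have := lk_O0 (K := K) (k : ZMod N)
      rwa [ZMod.val_natCast_of_lt (by omega)] at this
    · have h3 : (2 * k + 1) / 2 = k := by omega
      simp [vtO, h3] at h2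
      subst h2
      have := lk_O1 (K := K) (k : ZMod N)
      rwa [ZMod.val_natCast_of_lt (by omega)] at this

def emb (N K : ℕ) [NeZero N] : (MM N K).Embedding (FF N K) where
  boundary := bd N K
  conn := by
    have key : ∀ v, (MM N K).simple.Reachable none v := by
      intro v
      cases v with
      | none => exact SimpleGraph.Reachable.refl _
      | some d => exact SimpleGraph.Adj.reachable ⟨by simp, .inl d, rfl⟩
    exact { preconnected := fun u v => (key u).symm.trans (key v), nonempty := ⟨none⟩ }
  edge_twice := edge_tw
  link_conn := by
    intro v c c' h h'
    cases v with
    | none => exact EqvGen.trans _ _ _ (EqvGen.symm _ _ (lk_none c h)) (lk_none c' h')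
    | some d => exact EqvGen.trans _ _ _ (lk_some d c h) (EqvGen.symm _ _ (lk_some d c' h'))

lemma planarMM (N K : ℕ) [NeZero N] : IsPlanar (MM N K).simple := by
  refine ⟨_, _, _, ?_, ?_, ?_, MM N K, emb N K, ?_, SimpleGraph.Hom.id, fun _ _ h => h⟩
  · infer_instance
  · infer_instance
  · infer_instance
  · simp only [Embedding.eulerGenus, Nat.card_eq_fintype_card, Fintype.card_option,
      Fintype.card_sum, Fintype.card_prod, ZMod.card, Fintype.card_fin, Fintype.card_unit]
    push_cast
    ring_nf
    exact le_refl _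

/-- Any colouring of the graph with small classes has a rainbow K4. -/
lemma rainbow (m : ℕ) {W : Type} (h : Option (DD (m + 1) ((m + 1) * (2 * m + 1))) → W)
    (hm : ∀ (x : W) (k : ℕ) (g : Fin k → Option (DD (m + 1) ((m + 1) * (2 * m + 1)))),
      Function.Injective g → (∀ t, h (g t) = x) → k ≤ m) :
    ∃ (i : ZMod (m + 1)) (j : Fin ((m + 1) * (2 * m + 1))),
      h (some (i, 0)) ≠ h none ∧
      (∀ v ∈ [some (i, j.castSucc.succ), some (i, j.succ.succ)], h v ≠ h none ∧ h v ≠ h (some (i, 0))) ∧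
      h (some (i, j.castSucc.succ)) ≠ h (some (i, j.succ.succ)) := by
  classical
  obtain ⟨i, hi⟩ : ∃ i : ZMod (m + 1), h (some (i, 0)) ≠ h none := by
    by_contra! hc
    have := hm (h none) (m + 1) (fun t => some ((t.val : ZMod (m + 1)), 0)) (by
      intro a b hab
      simp only [Option.some.injEq, Prod.mk.injEq, and_true] at hab
      have := congrArg ZMod.val hab
      rw [ZMod.val_natCast_of_lt a.2, ZMod.val_natCast_of_lt b.2] at this
      exact Fin.ext this) (fun t => hc _)
    omega
  refine ⟨i, ?_⟩
  by_contra! hc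
  -- path vertices
  let p : ℕ → Option (DD (m + 1) ((m + 1) * (2 * m + 1))) := fun k =>
    some (i, Fin.ofNat _ (k + 1))
  have pinj : ∀ a b, a < (m + 1) * (2 * m + 1) → b < (m + 1) * (2 * m + 1) → p a = p b → a = b := by
    intro a b ha hb hab
    simp only [p, Option.some.injEq, Prod.mk.injEq, true_and] at hab
    have := congrArg Fin.val hab
    simp only [Fin.ofNat] at this
    rw [Nat.mod_eq_of_lt (by omega), Nat.mod_eq_of_lt (by omega)] at this
    omega
  have step : ∀ a, a < (m + 1) * (2 * m + 1) → h (p a) ≠ h none → h (p a) ≠ h (some (i, 0)) →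
      h (p (a + 1)) ≠ h none → h (p (a + 1)) ≠ h (some (i, 0)) → h (p a) = h (p (a + 1)) := by
    intro a ha h1 h2 h3 h4
    have e1 : p a = some (i, (⟨a, ha⟩ : Fin _).castSucc.succ) := by
      simp only [p, Option.some.injEq, Prod.mk.injEq, true_and, Fin.ext_iff, Fin.ofNat]
      rw [Nat.mod_eq_of_lt (by omega)]; rfl
    have e2 : p (a + 1) = some (i, (⟨a, ha⟩ : Fin _).succ.succ) := by
      simp only [p, Option.some.injEq, Prod.mk.injEq, true_and, Fin.ext_iff, Fin.ofNat]
      rw [Nat.mod_eq_of_lt (by omega)]; rfl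
    have := hc ⟨a, ha⟩ hi (by
      intro v hv
      simp only [List.mem_cons, List.not_mem_nil, or_false] at hv
      rw [← e1, ← e2] at hv
      rcases hv with rfl | rfl
      · exact ⟨h1, h2⟩
      · exact ⟨h3, h4⟩)
    rwa [← e1, ← e2] at this
  have lt : ∀ q r, q < 2 * m + 1 → r < m + 1 → (m + 1) * q + r < (m + 1) * (2 * m + 1) := by
    intro q r hq hr
    calc (m + 1) * q + r < (m + 1) * (q + 1) := by rw [mul_add]; omega
      _ ≤ _ := Nat.mul_le_mul_left _ hq
  -- every block contains a bad vertex
  have bad : ∀ q : Fin (2 * m + 1), ∃ r : Fin (m + 1),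
      h (p ((m + 1) * q + r)) = h none ∨ h (p ((m + 1) * q + r)) = h (some (i, 0)) := by
    intro q
    by_contra! hb
    have all : ∀ r, r < m + 1 → h (p ((m + 1) * q + r)) = h (p ((m + 1) * q)) := by
      intro r
      induction r with
      | zero => intro _; rfl
      | succ r ih =>
        intro hr
        rw [← ih (by omega)]
        have b1 := hb ⟨r, by omega⟩
        have b2 := hb ⟨r + 1, hr⟩
        exact (step _ (lt q r q.2 (by omega)) b1.1 b1.2 b2.1 b2.2).symm
    have := hm _ (m + 1) (fun r => p ((m + 1) * q + r)) (by
      intro a b hab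
      have := pinj _ _ (lt q a q.2 a.2) (lt q b q.2 b.2) hab
      exact Fin.ext (by omega)) (fun t => all t t.2)
    omega
  choose r hr using bad
  let g : Fin (2 * m + 1) → Option (DD (m + 1) ((m + 1) * (2 * m + 1))) :=
    fun q => p ((m + 1) * q + r q)
  have ginj : Function.Injective g := by
    intro a b hab
    have := pinj _ _ (lt a _ a.2 (r a).2) (lt b _ b.2 (r b).2) hab
    have h2 := congrArg (· / (m + 1)) this
    simp only [Nat.mul_add_div (Nat.succ_pos m), Nat.div_eq_of_lt (r a).2,
      Nat.div_eq_of_lt (r b).2] at h2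
    exact Fin.ext (by omega)
  have cnt : ∀ x, (Finset.univ.filter (fun q => h (g q) = x)).card ≤ m := by
    intro x
    set S := Finset.univ.filter (fun q => h (g q) = x) with hS
    refine hm x S.card (fun t => g (S.equivFin.symm t)) ?_ ?_
    · intro a b hab
      exact S.equivFin.symm.injective (Subtype.ext (ginj hab))
    · intro t
      exact (Finset.mem_filter.1 (S.equivFin.symm t).2).2
  have hun : (Finset.univ : Finset (Fin (2 * m + 1))) ⊆
      Finset.univ.filter (fun q => h (g q) = h none) ∪
      Finset.univ.filter (fun q => h (g q) = h (some (i, 0))) := by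
    intro q _
    simpa using hr q
  have h1 := (Finset.card_le_card hun).trans (Finset.card_union_le _ _)
  have h2 := cnt (h none)
  have h3 := cnt (h (some (i, 0)))
  simp only [Finset.card_univ, Fintype.card_fin] at h1
  omega

end Construction2

/-- For every integer `ℓ ≥ 0` there is a planar graph `G` such that, for every graph `H`
and every path `P`, if `G` is contained in `H ⊠ P ⊠ K_ℓ` then `H` has treewidth at
least 3. -/
theorem treewidth_lower_bound (ℓ : ℕ) :
    ∃ (U : Type) (G : SimpleGraph U), IsPlanar G ∧
      ∀ (W : Type) (H : SimpleGraph W) (n : ℕ),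
        G.IsContainedIn
          ((H.strongProd (SimpleGraph.pathGraph n)).strongProd (SimpleGraph.completeGraph (Fin ℓ))) →
        ¬ TreewidthLE H 2 := by
  refine ⟨_, (MM (3 * ℓ + 1) ((3 * ℓ + 1) * (2 * (3 * ℓ) + 1))).simple, planarMM _ _, ?_⟩
  rintro W H n ⟨f, hf⟩ hH
  have adj : ∀ u v, (∃ e, (MM (3 * ℓ + 1) ((3 * ℓ + 1) * (2 * (3 * ℓ) + 1))).ends e = s(u, v)) →
      (f u).1.1 ≠ (f v).1.1 → H.Adj (f u).1.1 (f v).1.1 := by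
    intro u v he hne
    have hadj := f.map_adj (show (MM _ _).simple.Adj u v from ⟨fun h => hne (by rw [h]), he⟩)
    obtain ⟨-, h1, -⟩ := hadj
    rcases h1 with h1 | h1
    · exact absurd (congrArg Prod.fst h1) hne
    · exact h1.2.1.resolve_left hne
  have lay : ∀ u, (f u).1.2.val ≤ (f none).1.2.val + 1 ∧ (f none).1.2.val ≤ (f u).1.2.val + 1 := by
    intro u
    cases u with
    | none => omega
    | some d =>
      have hadj := f.map_adj (show (MM _ _).simple.Adj none (some d) from ⟨by simp, .inl d, rfl⟩)
      obtain ⟨-, h1, -⟩ := hadj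
      rcases h1 with h1 | h1
      · have := congrArg (fun x => x.2.val) h1
        omega
      · rcases h1.2.2 with h2 | h2
        · have := congrArg Fin.val h2
          omega
        · rw [SimpleGraph.pathGraph_adj] at h2
          omega
  obtain ⟨i, j, h1, h2, h3⟩ := rainbow (3 * ℓ) (fun u => (f u).1.1) (by
    intro x k g hg hx
    let F : Fin k → Fin 3 × Fin ℓ := fun t =>
      (⟨(f (g t)).1.2.val + 1 - (f none).1.2.val, by have := lay (g t); omega⟩, (f (g t)).2)
    have hF : Function.Injective F := by
      intro a b hab
      apply hg
      apply hf
      have e1 := congrArg (fun x => x.1.val) hab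
      have e2 := congrArg Prod.snd hab
      simp only [F] at e1 e2
      have l1 := lay (g a)
      have l2 := lay (g b)
      refine Prod.ext (Prod.ext ((hx a).trans (hx b).symm) (Fin.ext ?_)) e2
      omega
    have := Fintype.card_le_of_injective F hF
    simpa using this)
  have ha := h2 _ List.mem_cons_self
  have hb := h2 _ (List.mem_cons_of_mem _ List.mem_cons_self)
  exact no_K4 hH (adj none _ ⟨.inl _, rfl⟩ h1.symm)
    (adj none _ ⟨.inl _, rfl⟩ ha.1.symm) (adj none _ ⟨.inl _, rfl⟩ hb.1.symm)
    (adj _ _ ⟨.inr (.inr (i, j.castSucc)), rfl⟩ ha.2.symm)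
    (adj _ _ ⟨.inr (.inr (i, j.succ)), rfl⟩ hb.2.symm)
    (adj _ _ ⟨.inr (.inl (i, j.castSucc.succ)), by
      have := nxt_castSucc (N := 3 * ℓ + 1) i j.succ
      rw [← Fin.succ_castSucc] at this
      simp [MM, this]⟩ h3)
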